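/- Let f : ℝ → ℝ be differentiable and strictly convex with derivative f' : ℝ → ℝ a bijection, and let f*(y) = sup_{x∈ℝ} (xy − f(x)) be its Fenchel conjugate (finite on the range of f'). Then every saddle point (ν*, ζ*) of the generalized min-max objective J_f(ν,ζ) satisfies ζ*(s,a) = f'((ν* − B^π ν*)(s,a)) = w(s,a) for every (s,a) ∈ S × A. -/

import Mathlib

open scoped BigOperators

/-- The t-step state distributions: `betaT T pi beta 0 = beta` and
`betaT T pi beta (t+1) s' = ∑ s, ∑ a, betaT T pi beta t s * pi s a * T s a s'`. -/
def betaT {S A : Type*} [Fintype S] [Fintype A]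
    (T : S → A → S → ℝ) (pi : S → A → ℝ) (beta : S → ℝ) : ℕ → S → ℝ
  | 0 => beta
  | t + 1 => fun s' => ∑ s, ∑ a, betaT T pi beta t s * pi s a * T s a s'

/-- The discounted occupancy `d^π(s,a) = (1−γ) ∑_t γ^t β_t(s) π(a|s)`. -/
noncomputable def dPi {S A : Type*} [Fintype S] [Fintype A]
    (γ : ℝ) (T : S → A → S → ℝ) (pi : S → A → ℝ) (beta : S → ℝ) (s : S) (a : A) : ℝ :=
  (1 - γ) * ∑' t : ℕ, γ ^ t * betaT T pi beta t s * pi s a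


/-- The (reward-free) expected Bellman operator
`(B^π ν)(s,a) = γ ∑_{s'} T(s'|s,a) ∑_{a'} π(a'|s') ν(s',a')`. -/
noncomputable def Bpi {S A : Type*} [Fintype S] [Fintype A]
    (γ : ℝ) (T : S → A → S → ℝ) (pi : S → A → ℝ) (ν : S → A → ℝ) (s : S) (a : A) : ℝ :=
  γ * ∑ s', T s a s' * ∑ a', pi s' a' * ν s' a'

theorem aux_fenchel (f : ℝ → ℝ) (hf : Differentiable ℝ f) (hconv : StrictConvexOn ℝ Set.univ f)
    (x₁ x : ℝ) : x * deriv f x₁ - f x ≤ x₁ * deriv f x₁ - f x₁ := by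
  have hc := hconv.convexOn
  have hd := (hf x₁).hasDerivAt
  rcases lt_trichotomy x x₁ with h | h | h
  · have := hc.slope_le_of_hasDerivAt (Set.mem_univ x) (Set.mem_univ x₁) h hd
    rw [slope_def_field, div_le_iff₀ (by linarith)] at this
    linarith
  · rw [h]
  · have := hc.le_slope_of_hasDerivAt (Set.mem_univ x₁) (Set.mem_univ x) h hd
    rw [slope_def_field, le_div_iff₀ (by linarith)] at this
    linarith

theorem aux_dual (f : ℝ → ℝ) (hf : Differentiable ℝ f) (hconv : StrictConvexOn ℝ Set.univ f)
    (hsurj : Function.Surjective (deriv f)) (fstar : ℝ → ℝ)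
    (hfstar : ∀ y : ℝ, fstar y = sSup (Set.range fun x : ℝ => x * y - f x))
    (x₀ z : ℝ) (h : ∀ y, x₀ * y - fstar y ≤ x₀ * z - fstar z) : z = deriv f x₀ := by
  have h1 : fstar (deriv f x₀) ≤ x₀ * deriv f x₀ - f x₀ := by
    rw [hfstar]
    apply csSup_le (Set.range_nonempty _)
    rintro _ ⟨x, rfl⟩
    exact aux_fenchel f hf hconv x₀ x
  have h2 : ∀ x, x * z - f x ≤ fstar z := by
    intro x
    obtain ⟨x₁, rfl⟩ := hsurj z
    rw [hfstar]
    refine le_csSup ?_ (Set.mem_range_self x)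
    refine ⟨x₁ * deriv f x₁ - f x₁, ?_⟩
    rintro _ ⟨x, rfl⟩
    exact aux_fenchel f hf hconv x₁ x
  have h3 := h (deriv f x₀)
  have h4 : IsLocalMax (fun x => x * z - f x) x₀ :=
    Filter.Eventually.of_forall fun x => by
      have := h2 x
      show x * z - f x ≤ x₀ * z - f x₀
      linarith
  have h5 : HasDerivAt (fun x => x * z - f x) (1 * z - deriv f x₀) x₀ :=
    ((hasDerivAt_id x₀).mul_const z).sub (hf x₀).hasDerivAt
  have := h4.hasDerivAt_eq_zero h5
  linarith

theorem aux_beta {S A : Type*} [Fintype S] [Fintype A]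
    (T : S → A → S → ℝ) (pi : S → A → ℝ) (beta : S → ℝ)
    (hT0 : ∀ s a s', 0 ≤ T s a s') (hT1 : ∀ s a, ∑ s', T s a s' = 1)
    (hpi0 : ∀ s a, 0 ≤ pi s a) (hpi1 : ∀ s, ∑ a, pi s a = 1)
    (hbeta0 : ∀ s, 0 ≤ beta s) (hbeta1 : ∑ s, beta s = 1) (t : ℕ) :
    (∀ s, 0 ≤ betaT T pi beta t s) ∧ ∑ s, betaT T pi beta t s = 1 := by
  induction t with
  | zero => exact ⟨hbeta0, hbeta1⟩
  | succ t ih =>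
    refine ⟨fun s => ?_, ?_⟩
    · exact Finset.sum_nonneg fun s' _ => Finset.sum_nonneg fun a _ =>
        mul_nonneg (mul_nonneg (ih.1 s') (hpi0 s' a)) (hT0 _ _ _)
    · simp only [betaT]
      rw [Finset.sum_comm]
      rw [← ih.2]
      refine Finset.sum_congr rfl fun s _ => ?_
      rw [Finset.sum_comm]
      simp only [← Finset.mul_sum, hT1, mul_one, hpi1]

theorem aux_flow {S A : Type*} [Fintype S] [Fintype A]
    (T : S → A → S → ℝ) (pi : S → A → ℝ) (beta : S → ℝ) (γ : ℝ)
    (hT0 : ∀ s a s', 0 ≤ T s a s') (hT1 : ∀ s a, ∑ s', T s a s' = 1)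
    (hpi0 : ∀ s a, 0 ≤ pi s a) (hpi1 : ∀ s, ∑ a, pi s a = 1)
    (hbeta0 : ∀ s, 0 ≤ beta s) (hbeta1 : ∑ s, beta s = 1)
    (hγ0 : 0 ≤ γ) (hγ1 : γ < 1) (s₀ : S) (a₀ : A) :
    dPi γ T pi beta s₀ a₀ = (1 - γ) * (beta s₀ * pi s₀ a₀)
      + ∑ s, ∑ a, dPi γ T pi beta s a * (γ * (T s a s₀ * pi s₀ a₀)) := by
  have hb := aux_beta T pi beta hT0 hT1 hpi0 hpi1 hbeta0 hbeta1
  have hsum : ∀ s, Summable fun t : ℕ => γ ^ t * betaT T pi beta t s := by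
    intro s
    refine Summable.of_nonneg_of_le (fun t => mul_nonneg (pow_nonneg hγ0 t) ((hb t).1 s))
      (fun t => ?_) (summable_geometric_of_lt_one hγ0 hγ1)
    have : betaT T pi beta t s ≤ 1 := by
      rw [← (hb t).2]
      exact Finset.single_le_sum (fun i _ => (hb t).1 i) (Finset.mem_univ s)
    exact mul_le_of_le_one_right (pow_nonneg hγ0 t) this
  have hd : ∀ s a, dPi γ T pi beta s a
      = (1 - γ) * ((∑' t : ℕ, γ ^ t * betaT T pi beta t s) * pi s a) := by
    intro s a
    rw [dPi, tsum_mul_right]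
  have hD : (∑' t : ℕ, γ ^ t * betaT T pi beta t s₀) = beta s₀
      + ∑ s, ∑ a, (∑' t : ℕ, γ ^ t * betaT T pi beta t s) * (γ * (pi s a * T s a s₀)) := by
    rw [(hsum s₀).tsum_eq_zero_add]
    congr 1
    · simp [betaT]
    · have : ∀ s a, HasSum (fun t : ℕ => γ ^ t * betaT T pi beta t s * (γ * (pi s a * T s a s₀)))
        ((∑' t : ℕ, γ ^ t * betaT T pi beta t s) * (γ * (pi s a * T s a s₀))) :=
        fun s a => (hsum s).hasSum.mul_right _
      have h2 := hasSum_sum (s := Finset.univ) fun s _ =>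
        hasSum_sum (s := Finset.univ) fun a _ => this s a
      rw [← h2.tsum_eq]
      congr 1
      ext t
      simp only [betaT, Finset.mul_sum]
      refine Finset.sum_congr rfl fun s _ => Finset.sum_congr rfl fun a _ => ?_
      ring
  rw [hd, hD, add_mul, mul_add, Finset.sum_mul, Finset.mul_sum]
  congr 1
  refine Finset.sum_congr rfl fun s _ => ?_
  rw [Finset.sum_mul, Finset.mul_sum]
  refine Finset.sum_congr rfl fun a _ => ?_
  rw [hd]
  ring

theorem aux_unique {S A : Type*} [Fintype S] [Fintype A]
    (T : S → A → S → ℝ) (pi : S → A → ℝ) (γ : ℝ)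
    (hT0 : ∀ s a s', 0 ≤ T s a s') (hT1 : ∀ s a, ∑ s', T s a s' = 1)
    (hpi0 : ∀ s a, 0 ≤ pi s a) (hpi1 : ∀ s, ∑ a, pi s a = 1)
    (hγ0 : 0 ≤ γ) (hγ1 : γ < 1) (e : S → A → ℝ)
    (he : ∀ s₀ a₀, e s₀ a₀ = ∑ s, ∑ a, e s a * (γ * (T s a s₀ * pi s₀ a₀))) :
    ∀ s a, e s a = 0 := by
  have h1 : ∀ s₀ a₀, |e s₀ a₀| ≤ ∑ s, ∑ a, |e s a| * (γ * (T s a s₀ * pi s₀ a₀)) := by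
    intro s₀ a₀
    rw [he s₀ a₀]
    refine (Finset.abs_sum_le_sum_abs _ _).trans (Finset.sum_le_sum fun s _ => ?_)
    refine (Finset.abs_sum_le_sum_abs _ _).trans (Finset.sum_le_sum fun a _ => ?_)
    rw [abs_mul, abs_of_nonneg (mul_nonneg hγ0 (mul_nonneg (hT0 s a s₀) (hpi0 s₀ a₀)))]
  have h2 : ∑ s, ∑ a, |e s a| ≤ γ * ∑ s, ∑ a, |e s a| := by
    calc ∑ s₀, ∑ a₀, |e s₀ a₀|
        ≤ ∑ s₀, ∑ a₀, ∑ s, ∑ a, |e s a| * (γ * (T s a s₀ * pi s₀ a₀)) :=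
          Finset.sum_le_sum fun s _ => Finset.sum_le_sum fun a _ => h1 s a
      _ = ∑ s₀, ∑ s, ∑ a, |e s a| * (γ * T s a s₀) := by
          refine Finset.sum_congr rfl fun s₀ _ => ?_
          rw [Finset.sum_comm]
          refine Finset.sum_congr rfl fun s _ => ?_
          rw [Finset.sum_comm]
          refine Finset.sum_congr rfl fun a _ => ?_
          simp only [← Finset.mul_sum, hpi1, mul_one]
      _ = γ * ∑ s, ∑ a, |e s a| := by
          rw [Finset.sum_comm, Finset.mul_sum]
          refine Finset.sum_congr rfl fun s _ => ?_
          rw [Finset.sum_comm, Finset.mul_sum]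
          refine Finset.sum_congr rfl fun a _ => ?_
          simp only [← Finset.mul_sum, hT1, mul_one]
          ring
  have h0 : 0 ≤ ∑ s, ∑ a, |e s a| :=
    Finset.sum_nonneg fun s _ => Finset.sum_nonneg fun a _ => abs_nonneg _
  have h3 : ∑ s, ∑ a, |e s a| = 0 := by nlinarith
  intro s a
  have h4 := (Finset.sum_eq_zero_iff_of_nonneg
    (fun s _ => Finset.sum_nonneg fun a _ => abs_nonneg (e s a))).1 h3 s (Finset.mem_univ s)
  have h5 := (Finset.sum_eq_zero_iff_of_nonneg (fun a _ => abs_nonneg (e s a))).1 h4 a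
    (Finset.mem_univ a)
  exact abs_eq_zero.1 h5

theorem aux_Bpi_lin {S A : Type*} [Fintype S] [Fintype A]
    (γ : ℝ) (T : S → A → S → ℝ) (pi : S → A → ℝ) (ν h : S → A → ℝ) (c : ℝ) (s : S) (a : A) :
    Bpi γ T pi (fun s a => ν s a + c * h s a) s a = Bpi γ T pi ν s a + c * Bpi γ T pi h s a := by
  simp only [Bpi, Finset.mul_sum]
  rw [← Finset.sum_add_distrib]
  refine Finset.sum_congr rfl fun s' _ => ?_
  rw [← Finset.sum_add_distrib]
  refine Finset.sum_congr rfl fun a' _ => ?_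
  ring

theorem generalized_saddle_point_dual_equals_correction
    {S A : Type*} [Fintype S] [Fintype A] [Nonempty S] [Nonempty A]
    (T : S → A → S → ℝ) (pi : S → A → ℝ) (beta : S → ℝ) (γ : ℝ) (dD : S → A → ℝ)
    (hT0 : ∀ s a s', 0 ≤ T s a s') (hT1 : ∀ s a, ∑ s', T s a s' = 1)
    (hpi0 : ∀ s a, 0 ≤ pi s a) (hpi1 : ∀ s, ∑ a, pi s a = 1)
    (hbeta0 : ∀ s, 0 ≤ beta s) (hbeta1 : ∑ s, beta s = 1)
    (hγ0 : 0 ≤ γ) (hγ1 : γ < 1)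
    (hdD0 : ∀ s a, 0 < dD s a) (hdD1 : ∑ s, ∑ a, dD s a = 1)
    (w : S → A → ℝ) (hw : ∀ s a, w s a = dPi γ T pi beta s a / dD s a)
    (f : ℝ → ℝ) (hf : Differentiable ℝ f) (hconv : StrictConvexOn ℝ Set.univ f)
    (hbij : Function.Bijective (deriv f))
    (fstar : ℝ → ℝ)
    (hfstar : ∀ y : ℝ, fstar y = sSup (Set.range fun x : ℝ => x * y - f x))
    (Jf : (S → A → ℝ) → (S → A → ℝ) → ℝ)
    (hJf : ∀ ν ζ : S → A → ℝ,
      Jf ν ζ = (∑ s, ∑ a, dD s a *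
                   ((ν s a - Bpi γ T pi ν s a) * ζ s a - fstar (ζ s a)))
                 - (1 - γ) * ∑ s, ∑ a, beta s * pi s a * ν s a)
    (νstar ζstar : S → A → ℝ)
    (hsaddle : ∀ ν ζ : S → A → ℝ,
      Jf νstar ζ ≤ Jf νstar ζstar ∧ Jf νstar ζstar ≤ Jf ν ζstar) :
    ∀ s a, ζstar s a = deriv f (νstar s a - Bpi γ T pi νstar s a) ∧
      ζstar s a = w s a := by
  classical
  have hdual : ∀ s a, ζstar s a = deriv f (νstar s a - Bpi γ T pi νstar s a) := by
    intro s₀ a₀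
    apply aux_dual f hf hconv hbij.2 fstar hfstar
    intro y
    have h := (hsaddle νstar (fun s a => if s = s₀ ∧ a = a₀ then y else ζstar s a)).1
    rw [hJf, hJf, sub_le_sub_iff_right, ← sub_nonneg, ← Finset.sum_sub_distrib] at h
    simp only [← Finset.sum_sub_distrib] at h
    rw [Finset.sum_eq_single s₀, Finset.sum_eq_single a₀] at h
    · simp only [and_self, if_true] at h
      rw [← mul_sub] at h
      have := nonneg_of_mul_nonneg_right h (hdD0 s₀ a₀)
      linarith
    · intro a _ ha
      simp [ha]
    · simp
    · intro s _ hs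
      simp [hs]
    · simp
  have hlin : ∀ h : S → A → ℝ, (∑ s, ∑ a, dD s a * ((h s a - Bpi γ T pi h s a) * ζstar s a))
      = (1 - γ) * ∑ s, ∑ a, beta s * pi s a * h s a := by
    intro h
    have hJ : ∀ c : ℝ, Jf (fun s a => νstar s a + c * h s a) ζstar = Jf νstar ζstar
        + c * ((∑ s, ∑ a, dD s a * ((h s a - Bpi γ T pi h s a) * ζstar s a))
          - (1 - γ) * ∑ s, ∑ a, beta s * pi s a * h s a) := by
      intro c
      rw [hJf, hJf]
      simp only [aux_Bpi_lin]
      have e1 : (∑ s, ∑ a, dD s a * ((νstar s a + c * h s a - (Bpi γ T pi νstar s a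
            + c * Bpi γ T pi h s a)) * ζstar s a - fstar (ζstar s a)))
          = (∑ s, ∑ a, dD s a * ((νstar s a - Bpi γ T pi νstar s a) * ζstar s a
            - fstar (ζstar s a)))
          + c * ∑ s, ∑ a, dD s a * ((h s a - Bpi γ T pi h s a) * ζstar s a) := by
        simp only [Finset.mul_sum, ← Finset.sum_add_distrib]
        refine Finset.sum_congr rfl fun s _ => Finset.sum_congr rfl fun a _ => ?_
        ring
      have e2 : (∑ s, ∑ a, beta s * pi s a * (νstar s a + c * h s a))
          = (∑ s, ∑ a, beta s * pi s a * νstar s a)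
          + c * ∑ s, ∑ a, beta s * pi s a * h s a := by
        simp only [Finset.mul_sum, ← Finset.sum_add_distrib]
        refine Finset.sum_congr rfl fun s _ => Finset.sum_congr rfl fun a _ => ?_
        ring
      rw [e1, e2]
      ring
    have p := (hsaddle (fun s a => νstar s a + 1 * h s a) ζstar).2
    have m := (hsaddle (fun s a => νstar s a + (-1) * h s a) ζstar).2
    rw [hJ] at p m
    linarith
  have hu : ∀ s₀ a₀, dD s₀ a₀ * ζstar s₀ a₀ = (1 - γ) * (beta s₀ * pi s₀ a₀)
      + ∑ s, ∑ a, (dD s a * ζstar s a) * (γ * (T s a s₀ * pi s₀ a₀)) := by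
    intro s₀ a₀
    have h := hlin (fun s a => if s = s₀ then (if a = a₀ then 1 else 0) else 0)
    have hB : ∀ s a, Bpi γ T pi (fun s a => if s = s₀ then (if a = a₀ then 1 else 0) else 0) s a
        = γ * (T s a s₀ * pi s₀ a₀) := by
      intro s a
      rw [Bpi, Finset.sum_eq_single s₀]
      · simp
      · intro s' _ hs
        simp [hs]
      · simp
    simp only [hB] at h
    have e1 : (∑ s, ∑ a, beta s * pi s a * (if s = s₀ then (if a = a₀ then (1:ℝ) else 0) else 0))
        = beta s₀ * pi s₀ a₀ := by
      rw [Finset.sum_eq_single s₀]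
      · simp
      · intro s' _ hs
        simp [hs]
      · simp
    have e2 : (∑ s, ∑ a, dD s a * ζstar s a
          * (if s = s₀ then (if a = a₀ then (1:ℝ) else 0) else 0))
        = dD s₀ a₀ * ζstar s₀ a₀ := by
      rw [Finset.sum_eq_single s₀]
      · simp
      · intro s' _ hs
        simp [hs]
      · simp
    rw [e1] at h
    rw [← h, ← e2]
    simp only [← Finset.sum_add_distrib]
    refine Finset.sum_congr rfl fun s _ => Finset.sum_congr rfl fun a _ => ?_
    ring
  have hz := aux_unique T pi γ hT0 hT1 hpi0 hpi1 hγ0 hγ1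
    (fun s a => dD s a * ζstar s a - dPi γ T pi beta s a) (by
      intro s₀ a₀
      have h1 := hu s₀ a₀
      have h2 := aux_flow T pi beta γ hT0 hT1 hpi0 hpi1 hbeta0 hbeta1 hγ0 hγ1 s₀ a₀
      simp only [sub_mul, Finset.sum_sub_distrib]
      linarith)
  intro s a
  refine ⟨hdual s a, ?_⟩
  rw [hw, eq_div_iff (hdD0 s a).ne']
  have := hz s a
  linarith
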